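/- arXiv:1306.4619 — 4 statements merged into one kernel-verified Lean document; each statement's English description precedes it below -/
import Mathlib

section
/- The initial value of the q-scale function is given by: if σ = 0 and ∫₀¹ z Π(dz) < ∞, then lim_{x↓0} W^{(q)}(x) = 1/c where c = γ + ∫₀¹ z Π(dz) (which is positive by assumption); and if σ > 0 or ∫₀¹ z Π(dz) = ∞, then lim_{x↓0} W^{(q)}(x) = 0. -/
open MeasureTheory Set Filter Topology

/-- The Laplace exponent of a spectrally negative Lévy process with triplet `(γ, σ, ν)`. -/
noncomputable def levyPsi (γ σ : ℝ) (ν : Measure ℝ) (l : ℝ) : ℝ :=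
  γ * l + σ ^ 2 / 2 * l ^ 2 +
    ∫ z in Set.Ioi (0 : ℝ),
      (Real.exp (-l * z) - 1 +
        l * z * Set.indicator (Set.Ioc (0 : ℝ) 1) (fun _ => (1 : ℝ)) z) ∂ν

/-- The right-inverse `Φ(q) = sup {λ ≥ 0 : f(λ) = q}` of a Laplace exponent `f`. -/
noncomputable def levyPhi (f : ℝ → ℝ) (q : ℝ) : ℝ :=
  sSup {l : ℝ | 0 ≤ l ∧ f l = q}

/-- `∫₀¹ z ν(dz)`, as an extended nonnegative real. -/
noncomputable def smallJumpMass (ν : Measure ℝ) : ENNReal :=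
  ∫⁻ z in Set.Ioc (0 : ℝ) 1, ENNReal.ofReal z ∂ν

/-- `ν` is a Lévy measure on `(0,∞)`: it charges only `(0,∞)` and
integrates `min(1, z²)`. -/
def IsLevyMeasure (ν : Measure ℝ) : Prop :=
  ν (Set.Iic 0) = 0 ∧ (∫⁻ z in Set.Ioi (0 : ℝ), ENNReal.ofReal (min 1 (z ^ 2)) ∂ν) ≠ ⊤

/-- The process is not the negative of a subordinator: `σ > 0`, or
`∫₀¹ z ν(dz) = ∞`, or `γ + ∫₀¹ z ν(dz) > 0`. -/
def NonDegenerate (γ σ : ℝ) (ν : Measure ℝ) : Prop :=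
  0 < σ ∨ smallJumpMass ν = ⊤ ∨ 0 < γ + (smallJumpMass ν).toReal

/-- `W` is the `q`-scale function associated with the Laplace exponent `f`,
where `Φq` is the value of the right-inverse of `f` at `q`. -/
def IsScaleFunction (f : ℝ → ℝ) (Φq q : ℝ) (W : ℝ → ℝ) : Prop :=
  (∀ x < 0, W x = 0) ∧ ContinuousOn W (Set.Ici 0) ∧ MonotoneOn W (Set.Ici 0) ∧
    ∀ l, Φq < l → (∫ y in Set.Ioi (0 : ℝ), Real.exp (-l * y) * W y) = 1 / (f l - q)

/-- Admissibility of the refraction parameter `α`: `α > 0`, and when the paths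
have bounded variation (`σ = 0` and `∫₀¹ z ν(dz) < ∞`), `α` is smaller than the
drift `c = γ + ∫₀¹ z ν(dz)`. -/
def AlphaAdmissible (γ σ α : ℝ) (ν : Measure ℝ) : Prop :=
  0 < α ∧ ((σ = 0 ∧ smallJumpMass ν ≠ ⊤) → α < γ + (smallJumpMass ν).toReal)

section JumpIntegrals

variable {ν : Measure ℝ}

lemma IsLevyMeasure.lintegral_sq_lt_top (hν : IsLevyMeasure ν) :
    ∫⁻ z in Ioc (0 : ℝ) 1, ENNReal.ofReal (z ^ 2) ∂ν < ⊤ := by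
  refine lt_of_le_of_lt ?_ hν.2.lt_top
  calc ∫⁻ z in Ioc (0 : ℝ) 1, ENNReal.ofReal (z ^ 2) ∂ν
      = ∫⁻ z in Ioc (0 : ℝ) 1, ENNReal.ofReal (min 1 (z ^ 2)) ∂ν := by
        refine setLIntegral_congr_fun measurableSet_Ioc fun z hz => ?_
        rw [min_eq_right (pow_le_one₀ hz.1.le hz.2)]
    _ ≤ _ := lintegral_mono_set Ioc_subset_Ioi_self

lemma IsLevyMeasure.measure_Ioi_one_lt_top (hν : IsLevyMeasure ν) : ν (Ioi 1) < ⊤ := by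
  refine lt_of_le_of_lt ?_ hν.2.lt_top
  calc ν (Ioi 1) = ∫⁻ z in Ioi (1 : ℝ), ENNReal.ofReal (min 1 (z ^ 2)) ∂ν := by
        rw [← setLIntegral_one]
        refine setLIntegral_congr_fun measurableSet_Ioi fun z hz => ?_
        rw [min_eq_left (one_le_pow₀ (le_of_lt hz)), ENNReal.ofReal_one]
    _ ≤ _ := lintegral_mono_set (Ioi_subset_Ioi zero_le_one)

lemma exp_neg_sub_one_add_nonneg (x : ℝ) : 0 ≤ Real.exp (-x) - 1 + x := by
  linarith [Real.one_sub_le_exp_neg x]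

lemma exp_neg_sub_one_add_le_sq {x : ℝ} (hx : 0 ≤ x) : Real.exp (-x) - 1 + x ≤ x ^ 2 := by
  have h1 : (1 + x) * Real.exp (-x) ≤ 1 := by
    calc (1 + x) * Real.exp (-x) ≤ Real.exp x * Real.exp (-x) := by
          gcongr; linarith [Real.add_one_le_exp x]
      _ = 1 := by rw [← Real.exp_add]; simp
  have h2 : Real.exp (-x) ≤ 1 := Real.exp_le_one_iff.2 (by linarith)
  nlinarith [mul_nonneg hx hx, mul_nonneg hx (sub_nonneg.2 h2), Real.one_sub_le_exp_neg x]

lemma exp_neg_sub_one_add_div_le {l x : ℝ} (hl : 0 ≤ l) (hx : 0 ≤ x) :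
    (Real.exp (-(l * x)) - 1 + l * x) / l ≤ x := by
  rcases hl.eq_or_lt with rfl | hl
  · simpa using hx
  rw [div_le_iff₀ hl]
  have : Real.exp (-(l * x)) ≤ 1 := Real.exp_le_one_iff.2 (by nlinarith)
  linarith

lemma tendsto_exp_neg_sub_one_add_div {x : ℝ} (hx : 0 < x) :
    Tendsto (fun n : ℕ => (Real.exp (-(n * x)) - 1 + n * x) / (n : ℝ)) atTop (𝓝 x) := by
  have h0 : Tendsto (fun n : ℕ => ((n : ℝ))⁻¹) atTop (𝓝 0) := tendsto_inv_atTop_nhds_zero_nat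
  have h1 : Tendsto (fun n : ℕ => Real.exp (-((n : ℝ) * x))) atTop (𝓝 0) :=
    Real.tendsto_exp_neg_atTop_nhds_zero.comp
      (tendsto_natCast_atTop_atTop.atTop_mul_const hx)
  have h2 : Tendsto (fun n : ℕ => (Real.exp (-((n : ℝ) * x)) - 1) * ((n : ℝ))⁻¹ + x) atTop
      (𝓝 ((0 - 1) * 0 + x)) := ((h1.sub_const 1).mul h0).add_const x
  simp only [mul_zero, zero_add] at h2
  refine h2.congr' ?_
  filter_upwards [eventually_gt_atTop 0] with n hn
  have : (n : ℝ) ≠ 0 := by positivity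
  field_simp

lemma IsLevyMeasure.integrableOn_small (hν : IsLevyMeasure ν) {l : ℝ} (hl : 0 ≤ l) :
    IntegrableOn (fun z => Real.exp (-(l * z)) - 1 + l * z) (Ioc 0 1) ν := by
  have hsq : IntegrableOn (fun z : ℝ => z ^ 2) (Ioc 0 1) ν := by
    refine ⟨by fun_prop, ?_⟩
    rw [hasFiniteIntegral_iff_ofReal (Eventually.of_forall fun z => sq_nonneg z)]
    exact hν.lintegral_sq_lt_top
  refine (hsq.const_mul (l ^ 2)).mono' (by fun_prop) ?_
  filter_upwards [ae_restrict_mem measurableSet_Ioc] with z hz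
  rw [Real.norm_of_nonneg (exp_neg_sub_one_add_nonneg _), ← mul_pow]
  exact exp_neg_sub_one_add_le_sq (mul_nonneg hl hz.1.le)

lemma norm_exp_neg_sub_one_le {x : ℝ} (hx : 0 ≤ x) : ‖Real.exp (-x) - 1‖ ≤ 1 := by
  have : Real.exp (-x) ≤ 1 := Real.exp_le_one_iff.2 (by linarith)
  rw [Real.norm_eq_abs, abs_le]
  constructor <;> linarith [Real.exp_pos (-x)]

lemma IsLevyMeasure.integrableOn_large (hν : IsLevyMeasure ν) {l : ℝ} (hl : 0 ≤ l) :
    IntegrableOn (fun z => Real.exp (-(l * z)) - 1) (Ioi 1) ν := by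
  refine Measure.integrableOn_of_bounded (M := 1) hν.measure_Ioi_one_lt_top.ne (by fun_prop) ?_
  filter_upwards [ae_restrict_mem measurableSet_Ioi] with z hz
  exact norm_exp_neg_sub_one_le (mul_nonneg hl (zero_le_one.trans (le_of_lt hz)))

/-- Separation of the jumps of size at most one from the larger ones. -/
lemma IsLevyMeasure.levyPsi_eq (hν : IsLevyMeasure ν) (γ σ : ℝ) {l : ℝ} (hl : 0 ≤ l) :
    levyPsi γ σ ν l = γ * l + σ ^ 2 / 2 * l ^ 2 +
      ((∫ z in Ioc (0 : ℝ) 1, (Real.exp (-(l * z)) - 1 + l * z) ∂ν) +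
        ∫ z in Ioi (1 : ℝ), (Real.exp (-(l * z)) - 1) ∂ν) := by
  have hs : EqOn (fun z => Real.exp (-l * z) - 1 +
      l * z * indicator (Ioc (0 : ℝ) 1) (fun _ => (1 : ℝ)) z)
      (fun z => Real.exp (-(l * z)) - 1 + l * z) (Ioc 0 1) := fun z hz => by
    simp [indicator_of_mem hz]
  have hL : EqOn (fun z => Real.exp (-l * z) - 1 +
      l * z * indicator (Ioc (0 : ℝ) 1) (fun _ => (1 : ℝ)) z)
      (fun z => Real.exp (-(l * z)) - 1) (Ioi 1) := fun z hz => by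
    have : z ∉ Ioc (0 : ℝ) 1 := fun h => not_lt.2 h.2 hz
    simp [indicator_of_notMem this]
  rw [levyPsi, ← Ioc_union_Ioi_eq_Ioi (zero_le_one (α := ℝ)),
    setIntegral_union (Ioc_disjoint_Ioi le_rfl) measurableSet_Ioi
      ((hν.integrableOn_small hl).congr_fun hs.symm measurableSet_Ioc)
      ((hν.integrableOn_large hl).congr_fun hL.symm measurableSet_Ioi),
    setIntegral_congr_fun measurableSet_Ioc hs, setIntegral_congr_fun measurableSet_Ioi hL]

lemma IsLevyMeasure.tendsto_integral_large_div (hν : IsLevyMeasure ν) :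
    Tendsto (fun n : ℕ => (∫ z in Ioi (1 : ℝ), (Real.exp (-(n * z)) - 1) ∂ν) / (n : ℝ))
      atTop (𝓝 0) := by
  refine squeeze_zero_norm (a := fun n : ℕ => ν.real (Ioi 1) / (n : ℝ)) (fun n => ?_)
    (tendsto_const_div_atTop_nhds_zero_nat _)
  rw [norm_div, Real.norm_natCast]
  gcongr
  have := norm_setIntegral_le_of_norm_le_const (μ := ν) (s := Ioi (1 : ℝ))
    (f := fun z => Real.exp (-(n * z)) - 1) (C := 1) hν.measure_Ioi_one_lt_top
    (fun z hz => norm_exp_neg_sub_one_le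
      (mul_nonneg n.cast_nonneg (zero_le_one.trans (le_of_lt hz))))
  simpa using this

lemma tendsto_integral_small_div_of_ne_top (hm : smallJumpMass ν ≠ ⊤) :
    Tendsto (fun n : ℕ =>
        (∫ z in Ioc (0 : ℝ) 1, (Real.exp (-(n * z)) - 1 + n * z) ∂ν) / (n : ℝ))
      atTop (𝓝 (smallJumpMass ν).toReal) := by
  have hpos : 0 ≤ᵐ[ν.restrict (Ioc 0 1)] fun z : ℝ => z := by
    filter_upwards [ae_restrict_mem measurableSet_Ioc] with z hz using hz.1.le
  have hid : IntegrableOn (fun z : ℝ => z) (Ioc 0 1) ν := by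
    refine ⟨by fun_prop, ?_⟩
    rw [hasFiniteIntegral_iff_ofReal hpos]
    exact hm.lt_top
  rw [smallJumpMass, ← integral_eq_lintegral_of_nonneg_ae hpos (by fun_prop)]
  simp_rw [← integral_div]
  refine tendsto_integral_of_dominated_convergence (fun z => z) (fun n => by fun_prop) hid
    (fun n => ?_) ?_
  · filter_upwards [ae_restrict_mem measurableSet_Ioc] with z hz
    rw [Real.norm_of_nonneg (div_nonneg (exp_neg_sub_one_add_nonneg _) n.cast_nonneg)]
    exact exp_neg_sub_one_add_div_le n.cast_nonneg hz.1.le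
  · filter_upwards [ae_restrict_mem measurableSet_Ioc] with z hz
    exact tendsto_exp_neg_sub_one_add_div hz.1

lemma IsLevyMeasure.tendsto_integral_small_div_of_eq_top (hν : IsLevyMeasure ν)
    (hm : smallJumpMass ν = ⊤) :
    Tendsto (fun n : ℕ =>
        (∫ z in Ioc (0 : ℝ) 1, (Real.exp (-(n * z)) - 1 + n * z) ∂ν) / (n : ℝ))
      atTop atTop := by
  rw [← ENNReal.tendsto_ofReal_nhds_top]
  refine tendsto_of_le_liminf_of_limsup_le ?_ le_top
  have heq : ∀ n : ℕ, ENNReal.ofReal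
      ((∫ z in Ioc (0 : ℝ) 1, (Real.exp (-(n * z)) - 1 + n * z) ∂ν) / (n : ℝ)) =
      ∫⁻ z in Ioc (0 : ℝ) 1,
        ENNReal.ofReal ((Real.exp (-(n * z)) - 1 + n * z) / (n : ℝ)) ∂ν := fun n => by
    rw [← integral_div, ofReal_integral_eq_lintegral_ofReal
      ((hν.integrableOn_small n.cast_nonneg).div_const _)
      (Eventually.of_forall fun z =>
        div_nonneg (exp_neg_sub_one_add_nonneg _) n.cast_nonneg)]
  simp_rw [heq]
  rw [← hm, smallJumpMass]
  refine le_trans (le_of_eq ?_) (lintegral_liminf_le fun n => by fun_prop)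
  refine setLIntegral_congr_fun measurableSet_Ioc fun z hz => ?_
  exact (ENNReal.tendsto_ofReal (tendsto_exp_neg_sub_one_add_div hz.1)).liminf_eq.symm

lemma IsLevyMeasure.levyPsi_div_eq (hν : IsLevyMeasure ν) (γ σ : ℝ) {n : ℕ} (hn : 0 < n) :
    levyPsi γ σ ν n / n = γ + σ ^ 2 / 2 * n +
      ((∫ z in Ioc (0 : ℝ) 1, (Real.exp (-(n * z)) - 1 + n * z) ∂ν) / (n : ℝ) +
        (∫ z in Ioi (1 : ℝ), (Real.exp (-(n * z)) - 1) ∂ν) / (n : ℝ)) := by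
  rw [hν.levyPsi_eq γ σ n.cast_nonneg]
  have : (n : ℝ) ≠ 0 := by positivity
  field_simp

lemma IsLevyMeasure.tendsto_levyPsi_div_of_bounded_variation (hν : IsLevyMeasure ν) (γ : ℝ)
    (hm : smallJumpMass ν ≠ ⊤) :
    Tendsto (fun n : ℕ => levyPsi γ 0 ν n / n) atTop
      (𝓝 (γ + (smallJumpMass ν).toReal)) := by
  have h := ((tendsto_integral_small_div_of_ne_top hm).add
    hν.tendsto_integral_large_div).const_add γ
  rw [add_zero] at h
  refine h.congr' ?_
  filter_upwards [eventually_gt_atTop 0] with n hn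
  rw [hν.levyPsi_div_eq γ 0 hn]
  ring

lemma IsLevyMeasure.tendsto_levyPsi_div_of_unbounded_variation (hν : IsLevyMeasure ν) (γ : ℝ)
    {σ : ℝ} (h : 0 < σ ∨ smallJumpMass ν = ⊤) :
    Tendsto (fun n : ℕ => levyPsi γ σ ν n / n) atTop atTop := by
  have key : Tendsto (fun n : ℕ => γ + (σ ^ 2 / 2 * n +
      (∫ z in Ioc (0 : ℝ) 1, (Real.exp (-(n * z)) - 1 + n * z) ∂ν) / (n : ℝ)) +
        (∫ z in Ioi (1 : ℝ), (Real.exp (-(n * z)) - 1) ∂ν) / (n : ℝ)) atTop atTop := by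
    refine Tendsto.atTop_add (tendsto_atTop_add_const_left _ _ ?_) hν.tendsto_integral_large_div
    rcases h with h | h
    · refine Tendsto.atTop_add_nonneg
        (tendsto_natCast_atTop_atTop.const_mul_atTop (by positivity)) fun n => ?_
      exact div_nonneg (integral_nonneg fun z => exp_neg_sub_one_add_nonneg _) n.cast_nonneg
    · exact Tendsto.nonneg_add_atTop (fun n => by positivity)
        (hν.tendsto_integral_small_div_of_eq_top h)
  refine key.congr' ?_
  filter_upwards [eventually_gt_atTop 0] with n hn
  rw [hν.levyPsi_div_eq γ σ hn]
  ring

end JumpIntegrals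

/-- The initial value theorem for the Laplace transform of a monotone function. -/
lemma tendsto_mul_laplace_of_monotoneOn {W : ℝ → ℝ} (hmono : MonotoneOn W (Ici 0))
    (hcont : ContinuousWithinAt W (Ici 0) 0) {b : ℝ} (hb : 0 < b)
    (hint : IntegrableOn (fun y => Real.exp (-b * y) * W y) (Ioi 0)) :
    Tendsto (fun n : ℕ => (n : ℝ) * ∫ y in Ioi (0 : ℝ), Real.exp (-n * y) * W y) atTop
      (𝓝 (W 0)) := by
  have hexp : IntegrableOn (fun u : ℝ => Real.exp (-u)) (Ioi 0) := by
    simpa using exp_neg_integrableOn_Ioi 0 one_pos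
  have hbound : IntegrableOn (fun u : ℝ => Real.exp (-u) * W (u / b)) (Ioi 0) := by
    rw [← mul_zero b, ← integrableOn_Ioi_comp_mul_left_iff _ _ hb]
    refine hint.congr_fun (fun u _ => ?_) measurableSet_Ioi
    simp [hb.ne']
  have hdom : Tendsto (fun n : ℕ => ∫ u in Ioi (0 : ℝ), Real.exp (-u) * W (u / n)) atTop
      (𝓝 (∫ u in Ioi (0 : ℝ), Real.exp (-u) * W 0)) := by
    refine tendsto_integral_filter_of_dominated_convergence
      (fun u => ‖Real.exp (-u) * W 0‖ + ‖Real.exp (-u) * W (u / b)‖) ?_ ?_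
      ((hexp.mul_const _).norm.add hbound.norm) ?_
    · refine Eventually.of_forall fun n => ?_
      refine AEStronglyMeasurable.mul (by fun_prop) ?_
      refine (aemeasurable_restrict_of_monotoneOn measurableSet_Ioi
        fun x hx y hy hxy => ?_).aestronglyMeasurable
      exact hmono (mem_Ici.2 (div_nonneg (mem_Ioi.1 hx).le n.cast_nonneg))
        (mem_Ici.2 (div_nonneg (mem_Ioi.1 hy).le n.cast_nonneg)) (by gcongr)
    · filter_upwards [tendsto_natCast_atTop_atTop.eventually_ge_atTop b] with n hn
      filter_upwards [ae_restrict_mem measurableSet_Ioi] with u hu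
      have hu : 0 < u := hu
      have hn0 : (0 : ℝ) < n := hb.trans_le hn
      have h1 : W 0 ≤ W (u / n) :=
        hmono (mem_Ici.2 le_rfl) (mem_Ici.2 (by positivity)) (by positivity)
      have h2 : W (u / n) ≤ W (u / b) :=
        hmono (mem_Ici.2 (by positivity)) (mem_Ici.2 (by positivity)) (by gcongr)
      simp only [norm_mul, ← mul_add]
      gcongr
      simp only [Real.norm_eq_abs]
      rw [abs_le]
      constructor <;> linarith [neg_abs_le (W 0), abs_nonneg (W (u / b)), abs_nonneg (W 0),
        le_abs_self (W (u / b))]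
    · filter_upwards [ae_restrict_mem measurableSet_Ioi] with u hu
      refine Tendsto.const_mul _ (hcont.tendsto.comp (tendsto_nhdsWithin_iff.2 ⟨?_, ?_⟩))
      · exact tendsto_const_div_atTop_nhds_zero_nat u
      · exact Eventually.of_forall fun n =>
          mem_Ici.2 (div_nonneg (mem_Ioi.1 hu).le n.cast_nonneg)
  rw [integral_mul_const, integral_exp_neg_Ioi_zero, one_mul] at hdom
  refine hdom.congr' ?_
  filter_upwards [eventually_gt_atTop 0] with n hn
  have hn0 : (0 : ℝ) < n := by exact_mod_cast hn
  have := integral_comp_mul_left_Ioi (fun u => Real.exp (-u) * W (u / n)) 0 hn0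
  rw [mul_zero, smul_eq_mul, eq_inv_mul_iff_mul_eq₀ hn0.ne'] at this
  rw [← this]
  congr 1
  refine setIntegral_congr_fun measurableSet_Ioi fun y _ => ?_
  simp [hn0.ne']

lemma IsScaleFunction.tendsto_zero {f W : ℝ → ℝ} {p q L : ℝ} (hW : IsScaleFunction f p q W)
    (hpos : ∀ᶠ n : ℕ in atTop, 0 < f n - q)
    (hlim : Tendsto (fun n : ℕ => (n : ℝ) / (f n - q)) atTop (𝓝 L)) :
    Tendsto W (𝓝[>] 0) (𝓝 L) := by
  obtain ⟨-, hcont, hmono, hlap⟩ := hW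
  have hp : ∀ᶠ n : ℕ in atTop, p < n := tendsto_natCast_atTop_atTop.eventually_gt_atTop p
  obtain ⟨b, hb0, hbp, hbf⟩ := ((eventually_gt_atTop 0).and (hp.and hpos)).exists
  have hc0 : ContinuousWithinAt W (Ici 0) 0 := hcont 0 (mem_Ici.2 le_rfl)
  have hint : IntegrableOn (fun y => Real.exp (-(b : ℝ) * y) * W y) (Ioi 0) := by
    refine not_imp_comm.1 integral_undef ?_
    rw [hlap b hbp]
    exact (one_div_pos.2 hbf).ne'
  have h := tendsto_mul_laplace_of_monotoneOn hmono hc0 (Nat.cast_pos.2 hb0) hint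
  have h' : Tendsto (fun n : ℕ => (n : ℝ) / (f n - q)) atTop (𝓝 (W 0)) := by
    refine h.congr' ?_
    filter_upwards [hp] with n hn
    rw [hlap n hn, mul_one_div]
  rw [tendsto_nhds_unique hlim h']
  exact hc0.tendsto.mono_left (nhdsWithin_mono _ Ioi_subset_Ici_self)

lemma IsScaleFunction.tendsto_zero_of_div {f W : ℝ → ℝ} {p q L : ℝ}
    (hW : IsScaleFunction f p q W)
    (hpos : ∀ᶠ n : ℕ in atTop, 0 < f n / n - q / n)
    (hlim : Tendsto (fun n : ℕ => (f n / n - q / n)⁻¹) atTop (𝓝 L)) :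
    Tendsto W (𝓝[>] 0) (𝓝 L) := by
  refine hW.tendsto_zero ?_ (hlim.congr fun n => ?_)
  · filter_upwards [hpos, eventually_gt_atTop 0] with n h hn
    rw [← sub_div] at h
    exact (div_pos_iff_of_pos_right (Nat.cast_pos.2 hn)).1 h
  · rw [← sub_div, inv_div]

/-- Initial value of the `q`-scale function: if `σ = 0` and `∫₀¹ z ν(dz) < ∞`, then
`lim_{x↓0} W^{(q)}(x) = 1/c` with `c = γ + ∫₀¹ z ν(dz)`; if `σ > 0` or `∫₀¹ z ν(dz) = ∞`,
then `lim_{x↓0} W^{(q)}(x) = 0`. -/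
theorem scale_function_initial_value
    (γ σ : ℝ) (hσ : 0 ≤ σ) (ν : Measure ℝ) (hν : IsLevyMeasure ν)
    (hnd : NonDegenerate γ σ ν)
    (q : ℝ) (hq : 0 ≤ q) (W : ℝ → ℝ)
    (hW : IsScaleFunction (levyPsi γ σ ν) (levyPhi (levyPsi γ σ ν) q) q W) :
    ((σ = 0 ∧ smallJumpMass ν ≠ ⊤) →
      Tendsto W (nhdsWithin 0 (Set.Ioi 0))
        (nhds (1 / (γ + (smallJumpMass ν).toReal)))) ∧
    ((0 < σ ∨ smallJumpMass ν = ⊤) →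
      Tendsto W (nhdsWithin 0 (Set.Ioi 0)) (nhds 0)) := by
  have hq0 : Tendsto (fun n : ℕ => q / (n : ℝ)) atTop (𝓝 0) :=
    tendsto_const_div_atTop_nhds_zero_nat q
  constructor
  · rintro ⟨rfl, hm⟩
    have hc : 0 < γ + (smallJumpMass ν).toReal :=
      (hnd.resolve_left (lt_irrefl 0)).resolve_left hm
    have h := (hν.tendsto_levyPsi_div_of_bounded_variation γ hm).sub hq0
    rw [sub_zero] at h
    rw [one_div]
    exact hW.tendsto_zero_of_div (h.eventually_const_lt hc) (h.inv₀ hc.ne')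
  · intro hs
    have h : Tendsto (fun n : ℕ => levyPsi γ σ ν n / n - q / n) atTop atTop := by
      simpa only [sub_eq_add_neg] using
        (hν.tendsto_levyPsi_div_of_unbounded_variation γ hs).atTop_add hq0.neg
    exact hW.tendsto_zero_of_div (h.eventually_gt_atTop 0) h.inv_tendsto_atTop
end

section
/- For all p, q ≥ 0 and all x ≥ 0, α∫₀ˣ 𝕎^{(p)}(x−y) W^{(q)}(y) dy + (p−q)∫₀ˣ ∫₀ʸ 𝕎^{(p)}(y−z) W^{(q)}(z) dz dy = ∫₀ˣ 𝕎^{(p)}(y) dy − ∫₀ˣ W^{(q)}(y) dy. -/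
open MeasureTheory Set Filter Topology

section LaplaceTransform

theorem integrableOn_exp_neg_mul_mono {g : ℝ → ℝ} {a l : ℝ}
    (hg : IntegrableOn (fun y => Real.exp (-a * y) * g y) (Ioi 0)) (hl : a ≤ l) :
    IntegrableOn (fun y => Real.exp (-l * y) * g y) (Ioi 0) := by
  have hfac : ∀ y, Real.exp (-l * y) * g y =
      Real.exp (-(l - a) * y) * (Real.exp (-a * y) * g y) := by
    intro y
    rw [← mul_assoc, ← Real.exp_add]
    ring_nf
  simp_rw [hfac]
  refine Integrable.bdd_mul (c := 1) hg (by fun_prop) ?_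
  refine ae_restrict_of_forall_mem measurableSet_Ioi fun y (hy : 0 < y) => ?_
  rw [Real.norm_eq_abs, Real.abs_exp, Real.exp_le_one_iff]
  nlinarith

theorem tendsto_laplace_atTop_zero {g : ℝ → ℝ} {a : ℝ}
    (hg : IntegrableOn (fun y => Real.exp (-a * y) * g y) (Ioi 0)) :
    Tendsto (fun l => ∫ y in Ioi (0 : ℝ), Real.exp (-l * y) * g y) atTop (𝓝 0) := by
  have := tendsto_integral_filter_of_dominated_convergence (l := atTop)
    (μ := volume.restrict (Ioi (0 : ℝ))) (F := fun l y => Real.exp (-l * y) * g y)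
    (f := fun _ => 0) (fun y => ‖Real.exp (-a * y) * g y‖)
    ((eventually_ge_atTop a).mono fun l hl =>
      (integrableOn_exp_neg_mul_mono hg hl).aestronglyMeasurable)
    ((eventually_ge_atTop a).mono fun l hl =>
      ae_restrict_of_forall_mem measurableSet_Ioi fun y (hy : 0 < y) => by
        simp only [norm_mul, Real.norm_eq_abs, Real.abs_exp]
        gcongr)
    hg.norm
    (ae_restrict_of_forall_mem measurableSet_Ioi fun y (hy : 0 < y) => by
      have hexp : Tendsto (fun l : ℝ => Real.exp (-l * y)) atTop (𝓝 0) :=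
        Real.tendsto_exp_atBot.comp (tendsto_neg_atTop_atBot.atBot_mul_const hy)
      simpa using hexp.mul_const (g y))
  simpa using this

theorem integral_comp_exp_neg_mul_eq_zero {g φ : ℝ → ℝ} (hg : IntegrableOn g (Ioi 0))
    (hmom : ∀ n : ℕ, ∫ y in Ioi (0 : ℝ), Real.exp (-n * y) * g y = 0)
    (hφ : ContinuousOn φ (Icc 0 1)) :
    ∫ y in Ioi (0 : ℝ), φ (Real.exp (-y)) * g y = 0 := by
  have hmem : ∀ y ∈ Ioi (0 : ℝ), Real.exp (-y) ∈ Icc (0 : ℝ) 1 := fun y (hy : 0 < y) =>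
    ⟨(Real.exp_pos _).le, Real.exp_le_one_iff.2 (by linarith)⟩
  have hint : ∀ f : ℝ → ℝ, ContinuousOn f (Icc 0 1) →
      IntegrableOn (fun y => f (Real.exp (-y)) * g y) (Ioi 0) := by
    intro f hf
    obtain ⟨C, hC⟩ := isCompact_Icc.exists_bound_of_continuousOn hf
    refine Integrable.bdd_mul (c := C) hg ?_ ?_
    · exact (hf.comp (by fun_prop) hmem).aestronglyMeasurable measurableSet_Ioi
    · exact ae_restrict_of_forall_mem measurableSet_Ioi fun y hy => hC _ (hmem y hy)
  have hpoly : ∀ p : Polynomial ℝ,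
      ∫ y in Ioi (0 : ℝ), p.eval (Real.exp (-y)) * g y = 0 := by
    intro p
    induction p using Polynomial.induction_on' with
    | add p q hp hq =>
      simp_rw [Polynomial.eval_add, add_mul]
      rw [integral_add (hint _ p.continuous.continuousOn) (hint _ q.continuous.continuousOn),
        hp, hq, add_zero]
    | monomial n c =>
      simp_rw [Polynomial.eval_monomial, mul_assoc, ← Real.exp_nat_mul, integral_const_mul]
      simp_rw [mul_neg, ← neg_mul]
      rw [hmom, mul_zero]
  set K := ∫ y in Ioi (0 : ℝ), ‖g y‖ with hK
  have hK0 : 0 ≤ K := integral_nonneg fun y => norm_nonneg _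
  have hbound : ∀ ε > 0, ‖∫ y in Ioi (0 : ℝ), φ (Real.exp (-y)) * g y‖ ≤ ε * K := by
    intro ε hε
    obtain ⟨p, hp⟩ := exists_polynomial_near_of_continuousOn 0 1 φ hφ ε hε
    have hpi := hint _ p.continuous.continuousOn
    calc ‖∫ y in Ioi (0 : ℝ), φ (Real.exp (-y)) * g y‖
        = ‖∫ y in Ioi (0 : ℝ), (p.eval (Real.exp (-y)) * g y - φ (Real.exp (-y)) * g y)‖ := by
          rw [integral_sub hpi (hint _ hφ), hpoly, zero_sub, norm_neg]
      _ ≤ ∫ y in Ioi (0 : ℝ), ε * ‖g y‖ := by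
          refine norm_integral_le_of_norm_le (hg.norm.const_mul ε) ?_
          refine ae_restrict_of_forall_mem measurableSet_Ioi fun y hy => ?_
          rw [← sub_mul, norm_mul]
          exact mul_le_mul_of_nonneg_right (hp _ (hmem y hy)).le (norm_nonneg _)
      _ = ε * K := integral_const_mul _ _
  refine norm_le_zero_iff.1 (le_of_forall_pos_le_add fun δ hδ => ?_)
  refine (hbound (δ / (K + 1)) (by positivity)).trans ?_
  rw [zero_add, div_mul_eq_mul_div, div_le_iff₀ (by positivity)]
  nlinarith

/-- Lerch's theorem for continuous functions. -/
theorem eqOn_zero_of_laplace_eq_zero {h : ℝ → ℝ} {a : ℝ} (hc : Continuous h)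
    (hi : ∀ l ≥ a, IntegrableOn (fun y => Real.exp (-l * y) * h y) (Ioi 0))
    (hz : ∀ l ≥ a, ∫ y in Ioi (0 : ℝ), Real.exp (-l * y) * h y = 0) :
    EqOn h 0 (Ioi 0) := by
  set g : ℝ → ℝ := fun y => Real.exp (-a * y) * h y with hgdef
  have hgc : Continuous g := by fun_prop
  have hmom : ∀ n : ℕ, ∫ y in Ioi (0 : ℝ), Real.exp (-n * y) * g y = 0 := by
    intro n
    refine (integral_congr_ae (Eventually.of_forall fun y => ?_)).trans (hz (a + n) (by simp))
    simp only [hgdef]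
    rw [← mul_assoc, ← Real.exp_add]
    ring_nf
  have hae : ∀ᵐ y, y ∈ Ioi (0 : ℝ) → g y = 0 := by
    refine isOpen_Ioi.ae_eq_zero_of_integral_contDiff_smul_eq_zero
      (hgc.locallyIntegrable.locallyIntegrableOn _) fun ψ hψ hψc hψs => ?_
    have hψ0 : ψ 0 = 0 := image_eq_zero_of_notMem_tsupport fun h0 => self_notMem_Ioi (hψs h0)
    have hφ : Continuous fun t : ℝ => ψ (-Real.log t) := by
      refine continuous_iff_continuousAt.2 fun t => ?_
      rcases eq_or_ne t 0 with rfl | ht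
      · rw [continuousAt_iff_punctured_nhds, Real.log_zero, neg_zero, hψ0]
        exact (hψc.is_zero_at_infty.mono_left atTop_le_cocompact).comp
          (tendsto_neg_atBot_atTop.comp Real.tendsto_log_nhdsNE_zero)
      · exact hψ.continuous.continuousAt.comp (Real.continuousAt_log ht).neg
    have hzero := integral_comp_exp_neg_mul_eq_zero (hi a le_rfl) hmom hφ.continuousOn
    simp only [Real.log_exp, neg_neg] at hzero
    rw [← hzero]
    refine (setIntegral_eq_integral_of_forall_compl_eq_zero fun y hy => ?_).symm
    rw [image_eq_zero_of_notMem_tsupport fun hy' => hy (hψs hy'), zero_smul]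
  have hEq : EqOn g 0 (Ioi 0) := Measure.eqOn_open_of_ae_eq (μ := volume)
    ((ae_restrict_iff' measurableSet_Ioi).2 hae) isOpen_Ioi hgc.continuousOn
    continuousOn_const
  exact fun y hy => (mul_eq_zero.1 (hEq hy)).resolve_left (Real.exp_pos _).ne'

theorem exp_neg_mul_integral_eq {u v : ℝ → ℝ} (l y : ℝ) :
    Real.exp (-l * y) * ∫ t in (0 : ℝ)..y, u t * v (y - t) =
      ∫ t in (0 : ℝ)..y, ContinuousLinearMap.mul ℝ ℝ (Real.exp (-l * t) * u t)
        (Real.exp (-l * (y - t)) * v (y - t)) := by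
  rw [← intervalIntegral.integral_const_mul]
  congr 1 with t
  have : Real.exp (-l * y) = Real.exp (-l * t) * Real.exp (-l * (y - t)) := by
    rw [← Real.exp_add]
    ring_nf
  rw [ContinuousLinearMap.mul_apply', this]
  ring

theorem integrableOn_laplace_convolution {u v : ℝ → ℝ} {l : ℝ}
    (hu : IntegrableOn (fun y => Real.exp (-l * y) * u y) (Ioi 0))
    (hv : IntegrableOn (fun y => Real.exp (-l * y) * v y) (Ioi 0)) :
    IntegrableOn (fun y => Real.exp (-l * y) * ∫ t in (0 : ℝ)..y, u t * v (y - t)) (Ioi 0) := by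
  simp_rw [exp_neg_mul_integral_eq]
  exact (integrable_indicator_iff measurableSet_Ioi).1
    (integrable_posConvolution hu hv (ContinuousLinearMap.mul ℝ ℝ))

theorem laplace_convolution {u v : ℝ → ℝ} {l : ℝ}
    (hu : IntegrableOn (fun y => Real.exp (-l * y) * u y) (Ioi 0))
    (hv : IntegrableOn (fun y => Real.exp (-l * y) * v y) (Ioi 0)) :
    ∫ y in Ioi (0 : ℝ), Real.exp (-l * y) * ∫ t in (0 : ℝ)..y, u t * v (y - t) =
      (∫ y in Ioi (0 : ℝ), Real.exp (-l * y) * u y) *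
        ∫ y in Ioi (0 : ℝ), Real.exp (-l * y) * v y := by
  simp_rw [exp_neg_mul_integral_eq]
  exact integral_posConvolution hu hv (ContinuousLinearMap.mul ℝ ℝ)

theorem integrableOn_laplace_one {l : ℝ} (hl : 0 < l) :
    IntegrableOn (fun y => Real.exp (-l * y) * 1) (Ioi 0) := by
  simpa using integrableOn_exp_mul_Ioi (neg_neg_of_pos hl) 0

theorem integrableOn_laplace_primitive {u : ℝ → ℝ} {l : ℝ} (hl : 0 < l)
    (hu : IntegrableOn (fun y => Real.exp (-l * y) * u y) (Ioi 0)) :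
    IntegrableOn (fun y => Real.exp (-l * y) * ∫ t in (0 : ℝ)..y, u t) (Ioi 0) := by
  simpa only [mul_one] using integrableOn_laplace_convolution hu (integrableOn_laplace_one hl)

theorem laplace_primitive {u : ℝ → ℝ} {l : ℝ} (hl : 0 < l)
    (hu : IntegrableOn (fun y => Real.exp (-l * y) * u y) (Ioi 0)) :
    ∫ y in Ioi (0 : ℝ), Real.exp (-l * y) * ∫ t in (0 : ℝ)..y, u t =
      (∫ y in Ioi (0 : ℝ), Real.exp (-l * y) * u y) * l⁻¹ := by
  have h := laplace_convolution hu (integrableOn_laplace_one hl)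
  simp only [mul_one] at h
  rw [h, integral_exp_mul_Ioi (neg_neg_of_pos hl)]
  simp

/-- If the Laplace transforms `A` of `u` and `B` of `v` satisfy `A - B = (α l + d) A B` for all
large `l`, then `α (u * v) + d (1 * u * v) = 1 * u - 1 * v`. -/
theorem convolution_identity_of_laplace {u v : ℝ → ℝ} (hu : Continuous u) (hv : Continuous v)
    {α d : ℝ}
    (hui : ∀ᶠ l in atTop, IntegrableOn (fun y => Real.exp (-l * y) * u y) (Ioi 0))
    (hvi : ∀ᶠ l in atTop, IntegrableOn (fun y => Real.exp (-l * y) * v y) (Ioi 0))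
    (h : ∀ᶠ l in atTop,
      (∫ y in Ioi (0 : ℝ), Real.exp (-l * y) * u y) -
          ∫ y in Ioi (0 : ℝ), Real.exp (-l * y) * v y =
        (α * l + d) * ((∫ y in Ioi (0 : ℝ), Real.exp (-l * y) * v y) *
          ∫ y in Ioi (0 : ℝ), Real.exp (-l * y) * u y))
    {x : ℝ} (hx : 0 ≤ x) :
    α * (∫ t in (0 : ℝ)..x, v t * u (x - t)) +
        d * (∫ y in (0 : ℝ)..x, ∫ t in (0 : ℝ)..y, v t * u (y - t)) =
      (∫ y in (0 : ℝ)..x, u y) - ∫ y in (0 : ℝ)..x, v y := by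
  rcases hx.eq_or_lt with rfl | hx
  · simp
  obtain ⟨a, ha⟩ := eventually_atTop.1 (((hui.and hvi).and h).and (eventually_gt_atTop 0))
  set c : ℝ → ℝ := fun y => ∫ t in (0 : ℝ)..y, v t * u (y - t) with hcdef
  have hc : Continuous c := by fun_prop
  set H : ℝ → ℝ := fun x => α * c x + d * (∫ y in (0 : ℝ)..x, c y) -
    ((∫ y in (0 : ℝ)..x, u y) - ∫ y in (0 : ℝ)..x, v y) with hHdef
  have hH : Continuous H := by fun_prop
  have hsplit : ∀ l y, Real.exp (-l * y) * H y =
      α * (Real.exp (-l * y) * c y) + d * (Real.exp (-l * y) * ∫ t in (0 : ℝ)..y, c t) -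
      (Real.exp (-l * y) * (∫ t in (0 : ℝ)..y, u t) -
        Real.exp (-l * y) * ∫ t in (0 : ℝ)..y, v t) := by
    intro l y
    rw [hHdef]
    ring
  have hzero : EqOn H 0 (Ioi 0) := by
    refine eqOn_zero_of_laplace_eq_zero (a := a) hH (fun l hl => ?_) fun l hl => ?_ <;>
    obtain ⟨⟨⟨h1, h2⟩, h3⟩, h4⟩ := ha l hl <;>
    have i1 := (integrableOn_laplace_convolution h2 h1).const_mul α <;>
    have i2 := (integrableOn_laplace_primitive h4
      (integrableOn_laplace_convolution h2 h1)).const_mul d <;>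
    have i3 := integrableOn_laplace_primitive h4 h1 <;>
    have i4 := integrableOn_laplace_primitive h4 h2 <;>
    simp_rw [hsplit]
    · exact (i1.add i2).sub (i3.sub i4)
    · refine (integral_sub (i1.add i2) (i3.sub i4)).trans ?_
      rw [integral_sub' i3 i4, integral_add' i1 i2, integral_const_mul, integral_const_mul,
        laplace_primitive h4 h1, laplace_primitive h4 h2,
        laplace_primitive h4 (integrableOn_laplace_convolution h2 h1),
        laplace_convolution h2 h1, ← sub_mul, h3]
      field_simp
      ring
  exact sub_eq_zero.1 (hzero hx)

end LaplaceTransform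

theorem IsScaleFunction.eventually_laplace {F Φ : ℝ → ℝ} {W : ℝ → ℝ → ℝ}
    (h : ∀ q, 0 ≤ q → IsScaleFunction F (Φ q) q (W q)) {q : ℝ} (hq : 0 ≤ q) :
    ∀ᶠ l in atTop, F l ≠ q ∧ IntegrableOn (fun y => Real.exp (-l * y) * W q y) (Ioi 0) ∧
      ∫ y in Ioi (0 : ℝ), Real.exp (-l * y) * W q y = 1 / (F l - q) := by
  have hval : ∀ q, 0 ≤ q → ∀ᶠ l in atTop,
      ∫ y in Ioi (0 : ℝ), Real.exp (-l * y) * W q y = 1 / (F l - q) := fun q hq =>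
    (eventually_gt_atTop (Φ q)).mono fun l hl => (h q hq).2.2.2 l hl
  have hint : ∀ q, 0 ≤ q → (∃ᶠ l in atTop, F l ≠ q) →
      ∃ a, IntegrableOn (fun y => Real.exp (-a * y) * W q y) (Ioi 0) := by
    intro q hq hne
    obtain ⟨l, hl, hl'⟩ := (hne.and_eventually (hval q hq)).exists
    refine ⟨l, not_imp_comm.1 integral_undef ?_⟩
    rw [hl']
    exact one_div_ne_zero (sub_ne_zero.2 hl)
  have hstep : ∀ q, 0 ≤ q → (∃ᶠ l in atTop, F l ≠ q + 1) → ∀ᶠ l in atTop, F l ≠ q := by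
    intro q hq hne
    obtain ⟨a, ha⟩ := hint (q + 1) (by linarith) hne
    have hlim := tendsto_laplace_atTop_zero ha
    filter_upwards [hval (q + 1) (by linarith), hlim.eventually (lt_mem_nhds neg_one_lt_zero)]
      with l h1 h2 h3
    rw [h1, h3] at h2
    norm_num at h2
  have hfreq : ∀ q, 0 ≤ q → ∃ᶠ l in atTop, F l ≠ q := by
    intro q hq hev
    have hev' : ∀ᶠ l in atTop, F l = q := hev.mono fun l hl => not_not.1 hl
    have := hstep q hq (hev'.mono fun l hl => by rw [hl]; linarith).frequently
    obtain ⟨l, h1, h2⟩ := (this.and hev').exists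
    exact h1 h2
  obtain ⟨a, ha⟩ := hint q hq (hfreq q hq)
  filter_upwards [hstep q hq (hfreq _ (by linarith)), eventually_ge_atTop a, hval q hq]
    with l h1 h2 h3
  exact ⟨h1, integrableOn_exp_neg_mul_mono ha h2, h3⟩

/-- For all `p, q ≥ 0` and `x ≥ 0`,
`α∫₀ˣ 𝕎^{(p)}(x-y) W^{(q)}(y) dy + (p-q)∫₀ˣ∫₀ʸ 𝕎^{(p)}(y-z) W^{(q)}(z) dz dy
  = ∫₀ˣ 𝕎^{(p)}(y) dy - ∫₀ˣ W^{(q)}(y) dy`,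
where `W^{(q)}` is the `q`-scale function of `X` and `𝕎^{(p)}` the `p`-scale function of
`Y = X - α·`. -/
theorem scale_function_convolution_integrated
    (γ σ : ℝ) (hσ : 0 ≤ σ) (ν : Measure ℝ) (hν : IsLevyMeasure ν)
    (hnd : NonDegenerate γ σ ν)
    (α : ℝ) (hα : AlphaAdmissible γ σ α ν)
    (W Wα : ℝ → ℝ → ℝ)
    (hW : ∀ q, 0 ≤ q →
      IsScaleFunction (levyPsi γ σ ν) (levyPhi (levyPsi γ σ ν) q) q (W q))
    (hWα : ∀ p, 0 ≤ p →
      IsScaleFunction (fun l => levyPsi γ σ ν l - α * l)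
        (levyPhi (fun l => levyPsi γ σ ν l - α * l) p) p (Wα p)) :
    ∀ p, 0 ≤ p → ∀ q, 0 ≤ q → ∀ x : ℝ, 0 ≤ x →
      α * (∫ y in (0:ℝ)..x, Wα p (x - y) * W q y) +
        (p - q) * ∫ y in (0:ℝ)..x, ∫ z in (0:ℝ)..y, Wα p (y - z) * W q z =
      (∫ y in (0:ℝ)..x, Wα p y) - ∫ y in (0:ℝ)..x, W q y := by
  intro p hp q hq x hx
  have hclamp : ∀ {f : ℝ → ℝ}, ContinuousOn f (Ici 0) → Continuous fun y => f (max 0 y) :=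
    fun hf => hf.comp_continuous (by fun_prop) fun y => le_max_left 0 y
  have hlap : ∀ (f : ℝ → ℝ) (l : ℝ), EqOn (fun y => Real.exp (-l * y) * f (max 0 y))
      (fun y => Real.exp (-l * y) * f y) (Ioi 0) := fun f l y (hy : 0 < y) => by
    simp only [max_eq_right hy.le]
  have hprim : ∀ (f : ℝ → ℝ), ∫ y in (0 : ℝ)..x, f (max 0 y) = ∫ y in (0 : ℝ)..x, f y := by
    intro f
    refine intervalIntegral.integral_congr fun y hy => ?_
    rw [uIcc_of_le hx] at hy
    simp only [max_eq_right hy.1]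
  have hconv : ∀ y, 0 ≤ y → ∫ t in (0 : ℝ)..y, W q (max 0 t) * Wα p (max 0 (y - t)) =
      ∫ t in (0 : ℝ)..y, Wα p (y - t) * W q t := by
    intro y hy
    refine intervalIntegral.integral_congr fun t ht => ?_
    rw [uIcc_of_le hy] at ht
    simp only [max_eq_right ht.1, max_eq_right (sub_nonneg.2 ht.2), mul_comm]
  have hdouble : ∫ y in (0 : ℝ)..x, ∫ t in (0 : ℝ)..y, W q (max 0 t) * Wα p (max 0 (y - t)) =
      ∫ y in (0 : ℝ)..x, ∫ t in (0 : ℝ)..y, Wα p (y - t) * W q t := by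
    refine intervalIntegral.integral_congr fun y hy => ?_
    rw [uIcc_of_le hx] at hy
    exact hconv y hy.1
  have hWl := IsScaleFunction.eventually_laplace hW hq
  have hWαl := IsScaleFunction.eventually_laplace hWα hp
  rw [← hprim (Wα p), ← hprim (W q), ← hconv x hx, ← hdouble]
  refine convolution_identity_of_laplace (u := fun y => Wα p (max 0 y))
    (v := fun y => W q (max 0 y)) (hclamp (hWα p hp).2.1) (hclamp (hW q hq).2.1)
    (hWαl.mono fun l hl => hl.2.1.congr_fun (hlap _ l).symm measurableSet_Ioi)
    (hWl.mono fun l hl => hl.2.1.congr_fun (hlap _ l).symm measurableSet_Ioi) ?_ hx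
  filter_upwards [hWl, hWαl] with l h1 h2
  rw [setIntegral_congr_fun measurableSet_Ioi (hlap (Wα p) l),
    setIntegral_congr_fun measurableSet_Ioi (hlap (W q) l), h1.2.2, h2.2.2]
  have n1 := sub_ne_zero.2 h1.1
  have n2 := sub_ne_zero.2 h2.1
  field_simp
  ring
end

section
/- For every c > b, z^{(q)}(c;0) − q∫_b^c 𝕎(c−y) z^{(q)}(y;0) dy = 1 + q∫₀^b 𝕎(c−y) ℤ^{(q)}(y) dy − αq∫₀^b W^{(q)}(z) { 𝕎(c−z) + q∫₀^{b−z} 𝕎(c−z−y) 𝕎^{(q)}(y) dy } dz. -/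
open MeasureTheory Set Filter Topology

/-- The function `w^{(q)}(·;0)` associated with the refracted process:
`w^{(q)}(x;0) = W^{(q)}(x) + α·1_{{x ≥ b}}∫_b^x 𝕎^{(q)}(x-y) W^{(q)′}(y) dy`. -/
noncomputable def refractedW (α b : ℝ) (W W' Wαq : ℝ → ℝ) (x : ℝ) : ℝ :=
  W x + α * (if b ≤ x then ∫ y in b..x, Wαq (x - y) * W' y else 0)

/-- The function `z^{(q)}(·;0)` associated with the refracted process:
`z^{(q)}(x;0) = Z^{(q)}(x) + αq·1_{{x ≥ b}}∫_b^x 𝕎^{(q)}(x-y) W^{(q)}(y) dy`,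
where `Z^{(q)}(x) = 1 + q∫₀ˣ W^{(q)}(y) dy`. -/
noncomputable def refractedZ (α b q : ℝ) (W Wαq : ℝ → ℝ) (x : ℝ) : ℝ :=
  (1 + q * ∫ y in (0:ℝ)..x, W y) +
    α * q * (if b ≤ x then ∫ y in b..x, Wαq (x - y) * W y else 0)

/-- `F` is continuous and `∫₀^∞ e^{-ly} F(y) dy = L(l)`, absolutely convergent, for all
large `l`. -/
structure HasLaplaceTransform (F L : ℝ → ℝ) : Prop where
  continuous : Continuous F
  eventually : ∀ᶠ l in atTop, IntegrableOn (fun y => Real.exp (-l * y) * F y) (Ioi 0) ∧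
    ∫ y in Ioi (0 : ℝ), Real.exp (-l * y) * F y = L l

namespace HasLaplaceTransform

variable {F G L M : ℝ → ℝ}

theorem congr (hF : HasLaplaceTransform F L) (h : L =ᶠ[atTop] M) : HasLaplaceTransform F M :=
  ⟨hF.continuous, by
    filter_upwards [hF.eventually, h] with l hl hLM using ⟨hl.1, hl.2.trans hLM⟩⟩

theorem add (hF : HasLaplaceTransform F L) (hG : HasLaplaceTransform G M) :
    HasLaplaceTransform (fun x => F x + G x) (fun l => L l + M l) := by
  refine ⟨hF.continuous.add hG.continuous, ?_⟩
  filter_upwards [hF.eventually, hG.eventually] with l hFl hGl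
  simp only [mul_add]
  exact ⟨hFl.1.add hGl.1, by rw [integral_add hFl.1 hGl.1, hFl.2, hGl.2]⟩

theorem const_mul (a : ℝ) (hF : HasLaplaceTransform F L) :
    HasLaplaceTransform (fun x => a * F x) (fun l => a * L l) := by
  refine ⟨hF.continuous.const_mul a, ?_⟩
  filter_upwards [hF.eventually] with l hl
  simp only [mul_left_comm _ a]
  exact ⟨hl.1.const_mul a, by rw [integral_const_mul, hl.2]⟩

theorem one : HasLaplaceTransform (fun _ => 1) (fun l => 1 / l) := by
  refine ⟨continuous_const, ?_⟩
  filter_upwards [eventually_gt_atTop 0] with l hl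
  simp only [mul_one]
  refine ⟨integrableOn_exp_mul_Ioi (by linarith) 0, ?_⟩
  rw [integral_exp_mul_Ioi (by linarith)]
  simp [neg_div_neg_eq]

theorem convolution (hF : HasLaplaceTransform F L) (hG : HasLaplaceTransform G M) :
    HasLaplaceTransform (fun x => ∫ t in (0 : ℝ)..x, F t * G (x - t)) (fun l => L l * M l) := by
  have hFc := hF.continuous
  have hGc := hG.continuous
  refine ⟨intervalIntegral.continuous_parametric_intervalIntegral_of_continuous
    (by fun_prop) continuous_id, ?_⟩
  filter_upwards [hF.eventually, hG.eventually] with l hFl hGl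
  have key (x : ℝ) : Real.exp (-l * x) * ∫ t in (0 : ℝ)..x, F t * G (x - t) =
      ∫ t in (0 : ℝ)..x, ContinuousLinearMap.mul ℝ ℝ (Real.exp (-l * t) * F t)
        (Real.exp (-l * (x - t)) * G (x - t)) := by
    rw [← intervalIntegral.integral_const_mul]
    refine intervalIntegral.integral_congr fun t _ => ?_
    simp only [ContinuousLinearMap.mul_apply']
    rw [show -l * x = -l * t + -l * (x - t) by ring, Real.exp_add]
    ring
  simp only [key]
  constructor
  · have := (integrable_posConvolution hFl.1 hGl.1 (ContinuousLinearMap.mul ℝ ℝ))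
    exact (integrable_indicator_iff measurableSet_Ioi).1 this
  · rw [integral_posConvolution hFl.1 hGl.1, hFl.2, hGl.2]
    rfl

theorem primitive (hF : HasLaplaceTransform F L) :
    HasLaplaceTransform (fun x => ∫ t in (0 : ℝ)..x, F t) (fun l => L l * (1 / l)) := by
  simpa using hF.convolution one

end HasLaplaceTransform

/-- A finite measure on `[0, ∞)` is determined by its Laplace transform at the natural numbers. -/
theorem NNReal.measure_ext_of_integral_exp_neg {P Q : Measure NNReal} [IsFiniteMeasure P]
    [IsFiniteMeasure Q]
    (h : ∀ n : ℕ, ∫ y, Real.exp (-(n * (y : ℝ))) ∂P = ∫ y, Real.exp (-(n * (y : ℝ))) ∂Q) :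
    P = Q := by
  let u : BoundedContinuousFunction NNReal ℝ :=
    BoundedContinuousFunction.ofNormedAddCommGroup (fun y : NNReal => Real.exp (-(y : ℝ)))
      (by fun_prop) 1 (fun y => by simp [Real.abs_exp])
  let A : StarSubalgebra ℝ (BoundedContinuousFunction NNReal ℝ) :=
    { (Polynomial.aeval (R := ℝ) u).range with
      star_mem' := fun {f} hf => by
        have : star f = f := by ext; simp
        rwa [this] }
  refine ext_of_forall_mem_subalgebra_integral_eq_of_pseudoEMetric_complete_countable
    (𝕜 := ℝ) (A := A) ?_ ?_
  · intro x y hxy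
    refine ⟨u, ⟨_, ⟨u, ⟨Polynomial.X, by simp⟩, rfl⟩, rfl⟩, ?_⟩
    simpa [u] using hxy
  · rintro g ⟨p, rfl⟩
    induction p using Polynomial.induction_on' with
    | add p r hp hr =>
      simp only [map_add, BoundedContinuousFunction.coe_add, Pi.add_apply] at hp hr ⊢
      rw [integral_add (BoundedContinuousFunction.integrable _ _)
        (BoundedContinuousFunction.integrable _ _), integral_add
        (BoundedContinuousFunction.integrable _ _) (BoundedContinuousFunction.integrable _ _)]
      exact congrArg₂ _ hp hr
    | monomial n a =>
      have hu (y : NNReal) : (Polynomial.aeval u (Polynomial.monomial n a)) y =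
          a * Real.exp (-(n * (y : ℝ))) := by
        rw [Polynomial.aeval_monomial, ← Algebra.smul_def]
        simp [u, ← Real.exp_nat_mul]
      change ∫ y, (Polynomial.aeval u (Polynomial.monomial n a)) y ∂P =
        ∫ y, (Polynomial.aeval u (Polynomial.monomial n a)) y ∂Q
      simp only [hu, integral_const_mul, h n]

/-- Lerch's theorem: a continuous function with vanishing Laplace transform vanishes. -/
theorem HasLaplaceTransform.eq_zero {F : ℝ → ℝ} (hF : HasLaplaceTransform F (fun _ => 0)) {x : ℝ}
    (hx : 0 < x) : F x = 0 := by
  obtain ⟨s, hs⟩ := eventually_atTop.1 hF.eventually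
  have hFc := hF.continuous
  set H : ℝ → ℝ := fun y => Real.exp (-s * y) * F y with hH
  have hHc : Continuous H := by fun_prop
  have hHi : IntegrableOn H (Ioi 0) := (hs s le_rfl).1
  let D (f : ℝ → ℝ) : Measure ℝ :=
    (volume.restrict (Ioi 0)).withDensity fun y => ENNReal.ofReal (f y)
  have hfin (f : ℝ → ℝ) (hf : IntegrableOn f (Ioi 0)) : IsFiniteMeasure (D f) :=
    isFiniteMeasure_withDensity_ofReal hf.2
  have := hfin H hHi
  have := hfin (fun y => -H y) hHi.neg
  have hint (f : ℝ → ℝ) (hf : Continuous f) (n : ℕ) :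
      ∫ y, Real.exp (-(n * (y : ℝ))) ∂((D f).map Real.toNNReal) =
        ∫ y in Ioi (0 : ℝ), max (f y) 0 * Real.exp (-(n * y)) := by
    rw [integral_map (by fun_prop) (by fun_prop),
      integral_withDensity_eq_integral_toReal_smul (by fun_prop) (by simp)]
    refine setIntegral_congr_fun measurableSet_Ioi fun y hy => ?_
    simp [ENNReal.toReal_ofReal', max_eq_left (le_of_lt (show (0 : ℝ) < y from hy))]
  have hmap : (D H).map Real.toNNReal = (D fun y => -H y).map Real.toNNReal := by
    refine NNReal.measure_ext_of_integral_exp_neg fun n => ?_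
    have hn := hs (s + n) (by simp)
    have hi : IntegrableOn (fun y => H y * Real.exp (-(n * y))) (Ioi 0) := by
      refine hn.1.congr_fun (fun y _ => ?_) measurableSet_Ioi
      simp only [hH]
      rw [show -(s + n) * y = -s * y + -(n * y) by ring, Real.exp_add]
      ring
    have hmul (a : ℝ) (y : ℝ) : max a 0 * Real.exp (-(n * y)) =
        max (a * Real.exp (-(n * y))) 0 := by
      rw [max_mul_of_nonneg _ _ (Real.exp_pos _).le, zero_mul]
    rw [hint H hHc, hint (fun y => -H y) hHc.neg, ← sub_eq_zero, ← integral_sub]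
    · refine (setIntegral_congr_fun measurableSet_Ioi fun y _ => ?_).trans hn.2
      simp only [hH]
      rw [show -(s + n) * y = -s * y + -(n * y) by ring, Real.exp_add, ← sub_mul,
        max_zero_sub_max_neg_zero_eq_self]
      ring
    · simp only [hmul]
      exact hi.pos_part
    · simp only [hmul, neg_mul]
      exact hi.neg_part
  have hback (f : ℝ → ℝ) : ((D f).map Real.toNNReal).map ((↑) : NNReal → ℝ) = D f := by
    rw [Measure.map_map (by fun_prop) (by fun_prop)]
    conv_rhs => rw [← Measure.map_id (μ := D f)]
    refine Measure.map_congr ?_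
    refine (withDensity_absolutelyContinuous _ _).ae_le ?_
    filter_upwards [ae_restrict_mem measurableSet_Ioi] with y hy
    simp [max_eq_left (le_of_lt (show (0 : ℝ) < y from hy))]
  have hD : D H = D fun y => -H y := by rw [← hback H, hmap, hback]
  have hae := (withDensity_eq_iff (by fun_prop) (by fun_prop)
    (by simpa [D] using measure_ne_top (D H) univ)).1 hD
  have hH0 : H =ᵐ[volume.restrict (Ioi 0)] fun _ => 0 := by
    filter_upwards [hae] with y hy
    have := congrArg ENNReal.toReal hy
    simp only [ENNReal.toReal_ofReal'] at this
    rcases le_total (H y) 0 with h | h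
    · rw [max_eq_right h, max_eq_left (by linarith)] at this; linarith
    · rw [max_eq_left h, max_eq_right (by linarith)] at this; linarith
  have := Measure.eqOn_open_of_ae_eq hH0 isOpen_Ioi hHc.continuousOn continuousOn_const hx
  simpa [hH, (Real.exp_pos _).ne'] using this

theorem HasLaplaceTransform.eq {F G L : ℝ → ℝ} (hF : HasLaplaceTransform F L)
    (hG : HasLaplaceTransform G L) {x : ℝ} (hx : 0 < x) : F x = G x := by
  have := ((hF.add (hG.const_mul (-1))).congr (M := fun _ => 0)
    (Eventually.of_forall fun l => by ring)).eq_zero hx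
  linarith

theorem IsLevyMeasure.measure_Ioi_lt_top {ν : Measure ℝ} (hν : IsLevyMeasure ν) {ε : ℝ}
    (hε : 0 < ε) (hε1 : ε ≤ 1) : ν (Ioi ε) < ⊤ := by
  have hint : IntegrableOn (fun z : ℝ => min 1 (z ^ 2)) (Ioi 0) ν :=
    (lintegral_ofReal_ne_top_iff_integrable (by fun_prop)
      (Eventually.of_forall fun z => by positivity)).1 hν.2
  have h := hint.measure_ge_lt_top (ε := ε ^ 2) (by positivity)
  rw [Measure.restrict_apply (measurableSet_le (by fun_prop) (by fun_prop))] at h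
  exact (measure_mono fun z (hz : ε < z) => mem_inter
    (show ε ^ 2 ≤ min 1 (z ^ 2) from le_min (by nlinarith) (by nlinarith)) (hε.trans hz)).trans_lt h

/-- The mean of the jumps in `(ε, 1]`. -/
noncomputable def truncatedJumpMean (ν : Measure ℝ) (ε : ℝ) : ℝ :=
  ∫ z in Ioi ε, z * (Ioc (0 : ℝ) 1).indicator (fun _ => (1 : ℝ)) z ∂ν

theorem IsLevyMeasure.integrableOn_truncated {ν : Measure ℝ} (hν : IsLevyMeasure ν) {ε : ℝ}
    (hε : 0 < ε) (hε1 : ε ≤ 1) :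
    IntegrableOn (fun z : ℝ => z * (Ioc (0 : ℝ) 1).indicator (fun _ => (1 : ℝ)) z) (Ioi ε) ν := by
  have := isFiniteMeasure_restrict.2 (hν.measure_Ioi_lt_top hε hε1).ne
  refine Integrable.of_bound (C := 1) (Measurable.aestronglyMeasurable
    (measurable_id.mul (measurable_const.indicator measurableSet_Ioc)))
    (Eventually.of_forall fun z => ?_)
  by_cases hz : z ∈ Ioc (0 : ℝ) 1
  · simp [hz, abs_of_pos hz.1, hz.2]
  · simp [hz]

theorem IsLevyMeasure.integrableOn_levyPsi {ν : Measure ℝ} (hν : IsLevyMeasure ν) {l : ℝ}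
    (hl : 0 ≤ l) :
    IntegrableOn (fun z => Real.exp (-l * z) - 1 +
        l * z * Set.indicator (Set.Ioc (0 : ℝ) 1) (fun _ => (1 : ℝ)) z) (Ioi 0) ν := by
  have hint : IntegrableOn (fun z : ℝ => min 1 (z ^ 2)) (Ioi 0) ν :=
    (lintegral_ofReal_ne_top_iff_integrable (by fun_prop)
      (Eventually.of_forall fun z => by positivity)).1 hν.2
  refine (hint.const_mul (1 + l ^ 2)).mono' (Measurable.aestronglyMeasurable
    ((by fun_prop : Measurable fun z : ℝ => Real.exp (-l * z) - 1).add
      ((by fun_prop : Measurable fun z : ℝ => l * z).mul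
        (measurable_const.indicator measurableSet_Ioc)))) ?_
  filter_upwards [ae_restrict_mem measurableSet_Ioi] with z hz
  have hz : 0 < z := hz
  have hlz : 0 ≤ l * z := by positivity
  have hexp := Real.exp_pos (-l * z)
  have hexp1 : Real.exp (-l * z) ≤ 1 := Real.exp_le_one_iff.2 (by linarith)
  have hlow := Real.add_one_le_exp (-l * z)
  rcases le_or_gt z 1 with h1 | h1
  · have hup : Real.exp (-l * z) ≤ 1 - l * z + (l * z) ^ 2 := by
      have h2 := Real.add_one_le_exp (l * z)
      have h3 : Real.exp (-l * z) * Real.exp (l * z) = 1 := by rw [← Real.exp_add]; simp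
      nlinarith [pow_nonneg hlz 3]
    rw [min_eq_right (by nlinarith), indicator_of_mem (mem_Ioc.2 ⟨hz, h1⟩), Real.norm_eq_abs,
      abs_of_nonneg (by linarith)]
    nlinarith
  · rw [min_eq_left (by nlinarith), indicator_of_notMem (fun h => absurd h.2 (not_le.2 h1)),
      Real.norm_eq_abs, abs_le]
    constructor <;> nlinarith

theorem IsLevyMeasure.le_levyPsi {ν : Measure ℝ} (hν : IsLevyMeasure ν) (γ σ : ℝ) {ε l : ℝ}
    (hε : 0 < ε) (hε1 : ε ≤ 1) (hl : 0 ≤ l) :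
    (γ + truncatedJumpMean ν ε) * l + σ ^ 2 / 2 * l ^ 2 - ν.real (Ioi ε) ≤ levyPsi γ σ ν l := by
  have := isFiniteMeasure_restrict.2 (hν.measure_Ioi_lt_top hε hε1).ne
  have hM := hν.integrableOn_truncated hε hε1
  have hψ := hν.integrableOn_levyPsi hl
  have hsub : Ioi ε ⊆ Ioi (0 : ℝ) := Ioi_subset_Ioi hε.le
  have h1 : ∫ z in Ioi ε, (l * (z * (Ioc (0 : ℝ) 1).indicator (fun _ => (1 : ℝ)) z) - 1) ∂ν =
      l * truncatedJumpMean ν ε - ν.real (Ioi ε) := by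
    rw [integral_sub (hM.const_mul l) (integrable_const _), integral_const_mul]
    simp [truncatedJumpMean, measureReal_def]
  have h2 : ∫ z in Ioi ε, (l * (z * (Ioc (0 : ℝ) 1).indicator (fun _ => (1 : ℝ)) z) - 1) ∂ν ≤
      ∫ z in Ioi ε, (Real.exp (-l * z) - 1 +
        l * z * Set.indicator (Set.Ioc (0 : ℝ) 1) (fun _ => (1 : ℝ)) z) ∂ν := by
    refine integral_mono ((hM.const_mul l).sub (integrable_const _)) (hψ.mono_set hsub)
      fun z => ?_
    have := Real.exp_pos (-l * z)
    simp only
    linarith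
  have hsplit := setIntegral_union (Ioc_disjoint_Ioi le_rfl) measurableSet_Ioi
    (hψ.mono_set (fun z (hz : z ∈ Ioc 0 ε) => hz.1)) (hψ.mono_set hsub)
  rw [Ioc_union_Ioi_eq_Ioi hε.le] at hsplit
  have h3 : 0 ≤ ∫ z in Ioc 0 ε, (Real.exp (-l * z) - 1 +
        l * z * Set.indicator (Set.Ioc (0 : ℝ) 1) (fun _ => (1 : ℝ)) z) ∂ν := by
    refine setIntegral_nonneg measurableSet_Ioc fun z hz => ?_
    rw [indicator_of_mem (mem_Ioc.2 ⟨hz.1, hz.2.trans hε1⟩)]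
    linarith [Real.add_one_le_exp (-l * z)]
  rw [levyPsi, hsplit]
  linarith

theorem IsLevyMeasure.exists_lt_truncatedJumpMean {ν : Measure ℝ} (hν : IsLevyMeasure ν) {r : ℝ}
    (hr : smallJumpMass ν ≠ ⊤ → r < (smallJumpMass ν).toReal) :
    ∃ ε, 0 < ε ∧ ε ≤ 1 ∧ r < truncatedJumpMean ν ε := by
  have hnonneg (z : ℝ) : 0 ≤ z * (Ioc (0 : ℝ) 1).indicator (fun _ => (1 : ℝ)) z := by
    by_cases hz : z ∈ Ioc (0 : ℝ) 1
    · simp [hz, hz.1.le]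
    · simp [hz]
  rcases lt_or_ge r 0 with hr0 | hr0
  · exact ⟨1, one_pos, le_rfl, hr0.trans_le (integral_nonneg hnonneg)⟩
  set φ : ℝ → ENNReal := fun z =>
    ENNReal.ofReal (z * (Ioc (0 : ℝ) 1).indicator (fun _ => (1 : ℝ)) z) with hφ
  have hunion : ⋃ n : ℕ, Ioi (1 / ((n : ℝ) + 1)) = Ioi (0 : ℝ) := by
    ext z
    simp only [mem_iUnion, mem_Ioi]
    exact ⟨fun ⟨n, hn⟩ => (by positivity : (0 : ℝ) < 1 / ((n : ℝ) + 1)).trans hn,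
      fun hz => exists_nat_one_div_lt hz⟩
  have hmass : smallJumpMass ν = ⨆ n : ℕ, ∫⁻ z in Ioi (1 / ((n : ℝ) + 1)), φ z ∂ν := by
    rw [← setLIntegral_iUnion_of_directed, hunion, smallJumpMass]
    · rw [← lintegral_indicator measurableSet_Ioc, ← lintegral_indicator measurableSet_Ioi]
      refine lintegral_congr fun z => ?_
      by_cases hz : z ∈ Ioc (0 : ℝ) 1
      · simp [hz, hφ, hz.1]
      · have : φ z = 0 := by simp [hφ, indicator_of_notMem hz]
        rw [indicator_of_notMem hz]
        simp [indicator_apply, this]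
    · refine Monotone.directed_le fun m n hmn => Ioi_subset_Ioi ?_
      gcongr
  have hlt : ENNReal.ofReal r < smallJumpMass ν := by
    by_cases h : smallJumpMass ν = ⊤
    · simp [h]
    · exact (ENNReal.ofReal_lt_iff_lt_toReal hr0 h).2 (hr h)
  rw [hmass, lt_iSup_iff] at hlt
  obtain ⟨n, hn⟩ := hlt
  have hn0 : 0 < 1 / ((n : ℝ) + 1) := by positivity
  have hn1 : 1 / ((n : ℝ) + 1) ≤ 1 := by
    rw [div_le_one (by positivity)]; linarith [n.cast_nonneg (α := ℝ)]
  refine ⟨_, hn0, hn1, ?_⟩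
  rw [← ofReal_integral_eq_lintegral_ofReal (hν.integrableOn_truncated hn0 hn1)
    (Eventually.of_forall hnonneg)] at hn
  exact (ENNReal.ofReal_lt_ofReal_iff_of_nonneg hr0).1 hn

theorem tendsto_levyPsi_sub_mul_atTop {γ σ α : ℝ} {ν : Measure ℝ} (hσ : 0 ≤ σ)
    (hν : IsLevyMeasure ν) (hα : AlphaAdmissible γ σ α ν) :
    Tendsto (fun l => levyPsi γ σ ν l - α * l) atTop atTop := by
  suffices h : ∃ ε, 0 < ε ∧ ε ≤ 1 ∧ Tendsto (fun l : ℝ =>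
      (γ + truncatedJumpMean ν ε - α + σ ^ 2 / 2 * l) * l + (-ν.real (Ioi ε))) atTop atTop by
    obtain ⟨ε, hε, hε1, h⟩ := h
    refine tendsto_atTop_mono' _ ?_ h
    filter_upwards [eventually_ge_atTop 0] with l hl
    linarith [hν.le_levyPsi γ σ hε hε1 hl]
  rcases hσ.eq_or_lt with rfl | hσ
  · obtain ⟨ε, hε, hε1, h⟩ := hν.exists_lt_truncatedJumpMean (r := α - γ)
      fun h => by linarith [hα.2 ⟨rfl, h⟩]
    refine ⟨ε, hε, hε1, tendsto_atTop_add_const_right _ _ ?_⟩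
    simpa using tendsto_id.const_mul_atTop (by linarith : 0 < γ + truncatedJumpMean ν ε - α)
  · refine ⟨1, one_pos, le_rfl, tendsto_atTop_add_const_right _ _ ?_⟩
    exact (tendsto_atTop_add_const_left _ _
      (tendsto_id.const_mul_atTop (by positivity))).atTop_mul_atTop₀ tendsto_id

theorem IsScaleFunction.hasLaplaceTransform {f W : ℝ → ℝ} {Φ q : ℝ}
    (hW : IsScaleFunction f Φ q W) (hf : Tendsto f atTop atTop) :
    HasLaplaceTransform (fun x => W (max x 0)) (fun l => 1 / (f l - q)) := by
  refine ⟨hW.2.1.comp_continuous (by fun_prop) fun x => le_max_right x 0, ?_⟩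
  have hmax (l : ℝ) : EqOn (fun y => Real.exp (-l * y) * W y)
      (fun y => Real.exp (-l * y) * W (max y 0)) (Ioi 0) := fun y hy => by
    simp only [max_eq_left (le_of_lt (mem_Ioi.1 hy))]
  filter_upwards [eventually_gt_atTop Φ, hf.eventually_gt_atTop q] with l hl hfl
  have h := hW.2.2.2 l hl
  refine ⟨IntegrableOn.congr_fun (Integrable.of_integral_ne_zero ?_) (hmax l) measurableSet_Ioi, ?_⟩
  · rw [h]
    exact one_div_ne_zero (sub_pos.2 hfl).ne'
  · rw [← setIntegral_congr_fun measurableSet_Ioi (hmax l), h]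

/-- The identity for continuous kernels satisfying the resolvent relations of scale functions. -/
theorem refracted_identity_of_resolvent {w v v₀ : ℝ → ℝ} (hw : Continuous w) (hv : Continuous v)
    (hv₀ : Continuous v₀) {α q b c : ℝ} (hb : 0 < b) (hbc : b < c)
    (h₁ : ∀ x > 0, v x = v₀ x + q * ∫ t in (0 : ℝ)..x, v t * v₀ (x - t))
    (h₂ : ∀ x > 0, ∫ t in (0 : ℝ)..x, v t =
      (∫ t in (0 : ℝ)..x, w t) + α * ∫ t in (0 : ℝ)..x, w t * v (x - t))
    (h₃ : ∀ x > 0, ∫ t in (0 : ℝ)..x, v t =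
      (∫ t in (0 : ℝ)..x, v₀ t) + q * ∫ t in (0 : ℝ)..x, (∫ s in (0 : ℝ)..t, v s) * v₀ (x - t)) :
    ((1 + q * ∫ y in (0 : ℝ)..c, w y) + α * q * ∫ y in b..c, v (c - y) * w y) -
        q * ∫ y in b..c, v₀ (c - y) *
          ((1 + q * ∫ z in (0 : ℝ)..y, w z) + α * q * ∫ z in b..y, v (y - z) * w z) =
      1 + q * (∫ y in (0 : ℝ)..b, v₀ (c - y) * (1 + q * ∫ z in (0 : ℝ)..y, v z)) -
        α * q * ∫ z in (0 : ℝ)..b, w z *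
          (v₀ (c - z) + q * ∫ y in (0 : ℝ)..(b - z), v₀ (c - z - y) * v y) := by
  have hVc : Continuous fun x => ∫ s in (0 : ℝ)..x, v s :=
    intervalIntegral.continuous_primitive (fun _ _ => hv.intervalIntegrable _ _) _
  have hz (x : ℝ) (hx : b ≤ x) :
      (1 + q * ∫ y in (0 : ℝ)..x, w y) + α * q * ∫ y in b..x, v (x - y) * w y =
        (1 + q * ∫ y in (0 : ℝ)..x, v y) - α * q * ∫ t in (0 : ℝ)..b, w t * v (x - t) := by
    have hadd := intervalIntegral.integral_add_adjacent_intervals (μ := volume)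
      (f := fun t => w t * v (x - t)) (a := 0) (b := b) (c := x)
      (Continuous.intervalIntegrable (by fun_prop) _ _)
      (Continuous.intervalIntegrable (by fun_prop) _ _)
    rw [h₂ x (hb.trans_le hx), ← hadd]
    simp only [mul_comm (v _)]
    ring
  have hinner : Continuous fun y => ∫ t in (0 : ℝ)..b, w t * v (y - t) :=
    intervalIntegral.continuous_parametric_intervalIntegral_of_continuous' (by fun_prop) _ _
  have hswap : ∫ y in b..c, v₀ (c - y) * ∫ t in (0 : ℝ)..b, w t * v (y - t) =
      ∫ t in (0 : ℝ)..b, w t * ∫ y in b..c, v₀ (c - y) * v (y - t) := by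
    simp only [← intervalIntegral.integral_const_mul]
    rw [intervalIntegral_intervalIntegral_swap]
    · simp only [mul_left_comm]
    · refine (Continuous.continuousOn (by fun_prop)).integrableOn_compact
        (isCompact_uIcc.prod isCompact_uIcc) |>.mono_set
        (prod_mono uIoc_subset_uIcc uIoc_subset_uIcc)
  have hsplit : ∫ y in b..c, v₀ (c - y) *
          ((1 + q * ∫ z in (0 : ℝ)..y, w z) + α * q * ∫ z in b..y, v (y - z) * w z) =
      (∫ y in b..c, v₀ (c - y) * (1 + q * ∫ z in (0 : ℝ)..y, v z)) -
        α * q * ∫ t in (0 : ℝ)..b, w t * ∫ y in b..c, v₀ (c - y) * v (y - t) := by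
    rw [← hswap, ← intervalIntegral.integral_const_mul, ← intervalIntegral.integral_sub
      (Continuous.intervalIntegrable (by fun_prop) _ _)
      (Continuous.intervalIntegrable (by fun_prop) _ _)]
    refine intervalIntegral.integral_congr fun y hy => ?_
    rw [uIcc_of_le hbc.le] at hy
    simp only [hz y hy.1]
    ring
  have hkernel (t : ℝ) (ht : t ∈ uIcc 0 b) :
      w t * (v₀ (c - t) + q * ∫ y in (0 : ℝ)..(b - t), v₀ (c - t - y) * v y) =
        w t * v (c - t) - q * (w t * ∫ y in b..c, v₀ (c - y) * v (y - t)) := by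
    rw [uIcc_of_le hb.le] at ht
    have hshift : ∫ y in b..c, v₀ (c - y) * v (y - t) =
        ∫ y in (b - t)..(c - t), v₀ (c - t - y) * v y := by
      rw [← intervalIntegral.integral_comp_sub_right (fun y => v₀ (c - t - y) * v y) t]
      simp
    have hadd := intervalIntegral.integral_add_adjacent_intervals (μ := volume)
      (f := fun y => v₀ (c - t - y) * v y) (a := 0) (b := b - t) (c := c - t)
      (Continuous.intervalIntegrable (by fun_prop) _ _)
      (Continuous.intervalIntegrable (by fun_prop) _ _)
    rw [h₁ (c - t) (by linarith [ht.2]), hshift]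
    simp only [mul_comm (v _)]
    rw [← hadd]
    ring
  have hres : q * ∫ y in (0 : ℝ)..c, v₀ (c - y) * (1 + q * ∫ z in (0 : ℝ)..y, v z) =
      q * ∫ z in (0 : ℝ)..c, v z := by
    have hrev : ∫ y in (0 : ℝ)..c, v₀ (c - y) = ∫ y in (0 : ℝ)..c, v₀ y := by
      simp [intervalIntegral.integral_comp_sub_left v₀ c]
    rw [h₃ c (hb.trans hbc), ← hrev, ← intervalIntegral.integral_const_mul q
      fun t => (∫ s in (0 : ℝ)..t, v s) * v₀ (c - t), ← intervalIntegral.integral_add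
      (Continuous.intervalIntegrable (by fun_prop) _ _)
      (Continuous.intervalIntegrable (by fun_prop) _ _)]
    congr 1
    refine intervalIntegral.integral_congr fun y _ => ?_
    ring
  have hadd := intervalIntegral.integral_add_adjacent_intervals (μ := volume)
    (f := fun y => v₀ (c - y) * (1 + q * ∫ z in (0 : ℝ)..y, v z)) (a := 0) (b := b) (c := c)
    (Continuous.intervalIntegrable (by fun_prop) _ _)
    (Continuous.intervalIntegrable (by fun_prop) _ _)
  have hinner' : Continuous fun t => ∫ y in b..c, v₀ (c - y) * v (y - t) :=
    intervalIntegral.continuous_parametric_intervalIntegral_of_continuous' (by fun_prop) _ _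
  rw [hz c hbc.le, hsplit, intervalIntegral.integral_congr hkernel, intervalIntegral.integral_sub
    (Continuous.intervalIntegrable (by fun_prop) _ _)
    (Continuous.intervalIntegrable (by fun_prop) _ _), intervalIntegral.integral_const_mul]
  rw [← hadd] at hres
  linarith

/-- For every `c > b`,
`z^{(q)}(c;0) - q∫_b^c 𝕎(c-y) z^{(q)}(y;0) dy
  = 1 + q∫₀^b 𝕎(c-y) ℤ^{(q)}(y) dy
    - αq∫₀^b W^{(q)}(z) { 𝕎(c-z) + q∫₀^{b-z} 𝕎(c-z-y) 𝕎^{(q)}(y) dy } dz`. -/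
theorem refracted_z_asymptotic_identity
    (γ σ : ℝ) (hσ : 0 ≤ σ) (ν : Measure ℝ) (hν : IsLevyMeasure ν)
    (hnd : NonDegenerate γ σ ν)
    (α : ℝ) (hα : AlphaAdmissible γ σ α ν)
    (b : ℝ) (hb : 0 < b) (q : ℝ) (hq : 0 ≤ q)
    (W Wαq Wα0 : ℝ → ℝ)
    (hW : IsScaleFunction (levyPsi γ σ ν) (levyPhi (levyPsi γ σ ν) q) q W)
    (hWαq : IsScaleFunction (fun l => levyPsi γ σ ν l - α * l)
      (levyPhi (fun l => levyPsi γ σ ν l - α * l) q) q Wαq)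
    (hWα0 : IsScaleFunction (fun l => levyPsi γ σ ν l - α * l)
      (levyPhi (fun l => levyPsi γ σ ν l - α * l) 0) 0 Wα0) :
    ∀ c : ℝ, b < c →
      refractedZ α b q W Wαq c -
          q * ∫ y in b..c, Wα0 (c - y) * refractedZ α b q W Wαq y =
        1 + q * (∫ y in (0:ℝ)..b, Wα0 (c - y) * (1 + q * ∫ z in (0:ℝ)..y, Wαq z)) -
          α * q * ∫ z in (0:ℝ)..b, W z *
            (Wα0 (c - z) + q * ∫ y in (0:ℝ)..(b - z), Wα0 (c - z - y) * Wαq y) := by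
  intro c hbc
  set P : ℝ → ℝ := fun l => levyPsi γ σ ν l - α * l with hP
  have hPt : Tendsto P atTop atTop := tendsto_levyPsi_sub_mul_atTop hσ hν hα
  have hψt : Tendsto (levyPsi γ σ ν) atTop atTop := by
    refine tendsto_atTop_mono' _ ?_ hPt
    filter_upwards [eventually_ge_atTop 0] with l hl
    have := mul_nonneg hα.1.le hl
    simp only [hP]
    linarith
  have hw := hW.hasLaplaceTransform hψt
  have hv := hWαq.hasLaplaceTransform hPt
  have hv₀ := hWα0.hasLaplaceTransform hPt
  have hne : ∀ᶠ l in atTop, 0 < l ∧ P l ≠ 0 ∧ P l - q ≠ 0 ∧ levyPsi γ σ ν l - q ≠ 0 := by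
    filter_upwards [eventually_gt_atTop 0, hPt.eventually_gt_atTop 0, hPt.eventually_gt_atTop q,
      hψt.eventually_gt_atTop q] with l h1 h2 h3 h4
    exact ⟨h1, h2.ne', (sub_pos.2 h3).ne', (sub_pos.2 h4).ne'⟩
  have key := refracted_identity_of_resolvent (α := α) (q := q) hw.continuous hv.continuous
    hv₀.continuous hb hbc
    (fun x hx => hv.eq ((hv₀.add ((hv.convolution hv₀).const_mul q)).congr (by
      filter_upwards [hne] with l ⟨hl, h0, hq, hψ⟩
      rw [sub_zero]
      field_simp
      ring)) hx)
    (fun x hx => hv.primitive.eq ((hw.primitive.add ((hw.convolution hv).const_mul α)).congr (by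
      filter_upwards [hne] with l ⟨hl, h0, hq, hψ⟩
      field_simp
      simp only [hP]
      ring)) hx)
    (fun x hx => hv.primitive.eq ((hv₀.primitive.add
      ((hv.primitive.convolution hv₀).const_mul q)).congr (by
      filter_upwards [hne] with l ⟨hl, h0, hq, hψ⟩
      rw [sub_zero]
      field_simp
      ring)) hx)
  have hmax (F : ℝ → ℝ) {x : ℝ} (hx : 0 ≤ x) : F (max x 0) = F x := by rw [max_eq_left hx]
  have hprim (F : ℝ → ℝ) {x : ℝ} (hx : 0 ≤ x) :
      ∫ y in (0 : ℝ)..x, F (max y 0) = ∫ y in (0 : ℝ)..x, F y := by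
    refine intervalIntegral.integral_congr fun y hy => hmax F ?_
    rw [uIcc_of_le hx] at hy
    exact hy.1
  have hz {x : ℝ} (hx : b ≤ x) : refractedZ α b q W Wαq x =
      (1 + q * ∫ y in (0 : ℝ)..x, W (max y 0)) +
        α * q * ∫ y in b..x, Wαq (max (x - y) 0) * W (max y 0) := by
    rw [refractedZ, if_pos hx, hprim W (hb.le.trans hx)]
    congr 2
    refine intervalIntegral.integral_congr fun y hy => ?_
    rw [uIcc_of_le hx] at hy
    simp only [hmax W (hb.le.trans hy.1), hmax Wαq (sub_nonneg.2 hy.2)]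
  convert key using 1
  · rw [hz hbc.le]
    congr 2
    refine intervalIntegral.integral_congr fun y hy => ?_
    rw [uIcc_of_le hbc.le] at hy
    simp only [hz hy.1, hmax Wα0 (sub_nonneg.2 hy.2)]
  · congr 1
    · congr 2
      refine intervalIntegral.integral_congr fun y hy => ?_
      rw [uIcc_of_le hb.le] at hy
      simp only [hprim Wαq hy.1, hmax Wα0 (by linarith [hy.2] : 0 ≤ c - y)]
    · congr 1
      refine intervalIntegral.integral_congr fun z hz => ?_
      rw [uIcc_of_le hb.le] at hz
      simp only [hmax W hz.1, hmax Wα0 (by linarith [hz.2] : 0 ≤ c - z)]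
      congr 3
      refine intervalIntegral.integral_congr fun y hy => ?_
      rw [uIcc_of_le (by linarith [hz.2])] at hy
      simp only [hmax Wαq hy.1, hmax Wα0 (by linarith [hy.2] : 0 ≤ c - z - y)]
end

section
/- lim_{x→∞} 𝕎(x) = 1/(ψ′(0+) − α), where ψ′(0+) denotes the (finite) right derivative of ψ at 0. -/
open MeasureTheory Set Filter Topology

lemma levyPsi_zero (γ σ : ℝ) (ν : Measure ℝ) : levyPsi γ σ ν 0 = 0 := by
  simp [levyPsi]

/-- If `f 0 = 0` and `f` has right derivative `d ≠ 0` at `0`, then `l / f l → 1 / d` as `l ↓ 0`. -/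
lemma tendsto_div_of_hasDerivWithinAt {f : ℝ → ℝ} {d : ℝ} (hf0 : f 0 = 0)
    (hf : HasDerivWithinAt f d (Ici 0) 0) (hd : d ≠ 0) :
    Tendsto (fun l => l / f l) (𝓝[>] 0) (𝓝 (1 / d)) := by
  have h := (hasDerivWithinAt_iff_tendsto_slope' (lt_irrefl (0 : ℝ))).1 hf.Ioi_of_Ici
  rw [one_div]
  refine (h.inv₀ hd).congr fun l => ?_
  simp [slope_def_field, hf0]

lemma integrableOn_exp_neg_mul_Ioi {l : ℝ} (hl : 0 < l) :
    IntegrableOn (fun y => Real.exp (-l * y)) (Ioi 0) :=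
  integrableOn_exp_mul_Ioi (neg_lt_zero.2 hl) 0

lemma integral_exp_neg_mul_Ioi {l : ℝ} (hl : 0 < l) :
    ∫ y in Ioi (0 : ℝ), Real.exp (-l * y) = 1 / l := by
  rw [integral_exp_mul_Ioi (neg_lt_zero.2 hl) 0]
  simp

/-- An upper bound of `W` bounds its normalized Laplace transform. -/
lemma mul_laplace_le_of_le {W : ℝ → ℝ} {a l : ℝ} (hl : 0 < l)
    (hint : IntegrableOn (fun y => Real.exp (-l * y) * W y) (Ioi 0))
    (hW : ∀ y, 0 < y → W y ≤ a) :
    l * ∫ y in Ioi (0 : ℝ), Real.exp (-l * y) * W y ≤ a := by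
  have h : ∫ y in Ioi (0 : ℝ), Real.exp (-l * y) * W y ≤
      ∫ y in Ioi (0 : ℝ), Real.exp (-l * y) * a :=
    setIntegral_mono_on hint ((integrableOn_exp_neg_mul_Ioi hl).mul_const a) measurableSet_Ioi
      fun y hy => mul_le_mul_of_nonneg_left (hW y hy) (Real.exp_pos _).le
  rw [integral_mul_const, integral_exp_neg_mul_Ioi hl] at h
  calc _ ≤ l * (1 / l * a) := mul_le_mul_of_nonneg_left h hl.le
    _ = a := by field_simp

/-- The normalized Laplace transform of a monotone function is at least any of its values, up to
an error vanishing as `l ↓ 0`. -/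
lemma le_mul_laplace_of_monotoneOn {W : ℝ → ℝ} {x l : ℝ} (hl : 0 < l) (hx : 0 ≤ x)
    (hint : IntegrableOn (fun y => Real.exp (-l * y) * W y) (Ioi 0))
    (hW : MonotoneOn W (Ici 0)) :
    W x - l * (x * (W x - W 0)) ≤ l * ∫ y in Ioi (0 : ℝ), Real.exp (-l * y) * W y := by
  have hind : IntegrableOn ((Ioc 0 x).indicator fun _ => W x - W 0) (Ioi 0) :=
    ((integrable_indicator_iff measurableSet_Ioc).2
      (integrableOn_const (by simp))).integrableOn
  have hexp : IntegrableOn (fun y => Real.exp (-l * y) * W x) (Ioi 0) :=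
    (integrableOn_exp_neg_mul_Ioi hl).mul_const _
  have h : ∫ y in Ioi (0 : ℝ),
        (Real.exp (-l * y) * W x - (Ioc 0 x).indicator (fun _ => W x - W 0) y) ≤
      ∫ y in Ioi (0 : ℝ), Real.exp (-l * y) * W y := by
    refine setIntegral_mono_on (hexp.sub hind) hint measurableSet_Ioi fun y hy => ?_
    have hy : 0 < y := hy
    by_cases hyx : y ≤ x
    · have h0 : W 0 ≤ W y := hW self_mem_Ici hy.le hy.le
      have h1 : W y ≤ W x := hW hy.le hx hyx
      have he : Real.exp (-l * y) ≤ 1 := Real.exp_le_one_iff.2 (by nlinarith)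
      rw [indicator_of_mem (show y ∈ Ioc 0 x from ⟨hy, hyx⟩)]
      nlinarith [Real.exp_pos (-l * y)]
    · rw [indicator_of_notMem (fun h => hyx h.2), sub_zero]
      exact mul_le_mul_of_nonneg_left (hW hx hy.le (not_le.1 hyx).le) (Real.exp_pos _).le
  rw [integral_sub hexp hind, integral_mul_const, integral_exp_neg_mul_Ioi hl,
    setIntegral_indicator measurableSet_Ioc,
    inter_eq_self_of_subset_right Ioc_subset_Ioi_self, setIntegral_const,
    Real.volume_real_Ioc_of_le hx, smul_eq_mul, sub_zero] at h
  calc _ = l * (1 / l * W x - x * (W x - W 0)) := by field_simp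
    _ ≤ _ := mul_le_mul_of_nonneg_left h hl.le

/-- A Tauberian theorem for monotone functions: the Abelian mean of `W` at infinity is its
limit. -/
lemma tendsto_atTop_of_tendsto_mul_laplace {W : ℝ → ℝ} {c : ℝ} (hW : MonotoneOn W (Ici 0))
    (hint : ∀ᶠ l in 𝓝[>] (0 : ℝ), IntegrableOn (fun y => Real.exp (-l * y) * W y) (Ioi 0))
    (hlim : Tendsto (fun l => l * ∫ y in Ioi (0 : ℝ), Real.exp (-l * y) * W y)
      (𝓝[>] 0) (𝓝 c)) :
    Tendsto W atTop (𝓝 c) := by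
  have hle : ∀ x, 0 ≤ x → W x ≤ c := fun x hx => by
    have h : Tendsto (fun l : ℝ => W x - l * (x * (W x - W 0))) (𝓝[>] 0) (𝓝 (W x)) := by
      refine Tendsto.mono_left ?_ nhdsWithin_le_nhds
      have hc : Continuous fun l : ℝ => W x - l * (x * (W x - W 0)) := by fun_prop
      simpa using hc.tendsto 0
    refine le_of_tendsto_of_tendsto h hlim ?_
    filter_upwards [hint, self_mem_nhdsWithin] with l hl hpos
    exact le_mul_laplace_of_monotoneOn hpos hx hl hW
  refine tendsto_order.2 ⟨fun a ha => ?_, fun a ha => ?_⟩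
  · obtain ⟨x, hx, hax⟩ : ∃ x, 0 < x ∧ a < W x := by
      by_contra! hcon
      refine ha.not_ge (le_of_tendsto hlim ?_)
      filter_upwards [hint, self_mem_nhdsWithin] with l hl hpos
      exact mul_laplace_le_of_le hpos hl hcon
    filter_upwards [eventually_ge_atTop x] with y hy
    exact hax.trans_le (hW hx.le (hx.le.trans hy) hy)
  · filter_upwards [eventually_ge_atTop 0] with y hy
    exact (hle y hy).trans_lt ha

/-- Under the net profit condition `ψ′(0+) > α`, the `0`-scale function `𝕎` of the
refracted process `Y = X - α·` satisfies `lim_{x→∞} 𝕎(x) = 1/(ψ′(0+) - α)`. -/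
theorem scale_function_limit_at_top
    (γ σ : ℝ) (hσ : 0 ≤ σ) (ν : Measure ℝ) (hν : IsLevyMeasure ν)
    (hbig : (∫⁻ z in Set.Ioi (1 : ℝ), ENNReal.ofReal z ∂ν) ≠ ⊤)
    (ψ'0 : ℝ) (hder : HasDerivWithinAt (levyPsi γ σ ν) ψ'0 (Set.Ici 0) 0)
    (α : ℝ) (hα : 0 < α) (hprofit : α < ψ'0)
    (Wα0 : ℝ → ℝ)
    (hWα0 : IsScaleFunction (fun l => levyPsi γ σ ν l - α * l) 0 0 Wα0) :
    Tendsto Wα0 atTop (nhds (1 / (ψ'0 - α))) := by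
  obtain ⟨-, -, hmono, hlap⟩ := hWα0
  have hd : 0 < ψ'0 - α := sub_pos.2 hprofit
  have hf : HasDerivWithinAt (fun l => levyPsi γ σ ν l - α * l) (ψ'0 - α) (Ici 0) 0 := by
    have h := hder.sub ((hasDerivWithinAt_id (0 : ℝ) (Ici 0)).const_mul α)
    rwa [mul_one] at h
  have hlim := tendsto_div_of_hasDerivWithinAt (by simp [levyPsi_zero]) hf hd.ne'
  refine tendsto_atTop_of_tendsto_mul_laplace hmono ?_ ?_
  · filter_upwards [hlim.eventually_ne (one_div_pos.2 hd).ne', self_mem_nhdsWithin] with l hl hpos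
    refine Integrable.of_integral_ne_zero ?_
    rw [hlap l hpos, sub_zero]
    exact one_div_ne_zero fun h => hl (by simp [h])
  · refine hlim.congr' ?_
    filter_upwards [self_mem_nhdsWithin] with l hpos
    rw [hlap l hpos, sub_zero, mul_one_div]
end
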